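/- Let (X,κ) be a digitally connected finite digital image having more than one point. If X is irreducible, then TC(X,κ) > 1. -/

import Mathlib

/-! Basic digital topology definitions (digital images, adjacencies, continuity,
homotopy, contractibility, reducibility, simple closed curves, loops,
digital (higher) topological complexity). -/

/-- 2-adjacency on `ℤ`. -/
def adjZ (a b : ℤ) : Prop := |a - b| = 1

/-- 4-adjacency (`c₁`) on `ℤ²`. -/
def adj4 (p q : ℤ × ℤ) : Prop :=
  (|p.1 - q.1| = 1 ∧ p.2 = q.2) ∨ (p.1 = q.1 ∧ |p.2 - q.2| = 1)

/-- 8-adjacency (`c₂`) on `ℤ²`. -/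
def adj8 (p q : ℤ × ℤ) : Prop :=
  p ≠ q ∧ |p.1 - q.1| ≤ 1 ∧ |p.2 - q.2| ≤ 1

/-- The adjacency relation on `ℤ²` named by `κ ∈ {4, 8}`. -/
def adjK (κ : ℕ) : ℤ × ℤ → ℤ × ℤ → Prop := if κ = 4 then adj4 else adj8

/-- The `c_k`-adjacency on `ℤⁿ`: distinct points, coordinates differing by `1` in at
most `k` indices, all other coordinates equal. -/
def cAdj (n k : ℕ) (x y : Fin n → ℤ) : Prop :=
  x ≠ y ∧ ((Finset.univ.filter fun i => x i ≠ y i).card ≤ k) ∧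
    ∀ i, x i ≠ y i → |x i - y i| = 1

/-- A digital path of length `len`, given by a function on `ℤ` (only its values on
`[0, len]` matter). -/
structure DigPath (α : Type) where
  len : ℕ
  toFun : ℤ → α

/-- An element `(f, p₁, …, pₙ)` of (the ambient type of) `Sₙ(X)`. -/
structure SnElt (α : Type) (n : ℕ) where
  path : DigPath α
  pts : Fin n → α

section

variable {α β : Type} (A : α → α → Prop) (B : β → β → Prop)

/-- `f` maps the digital image `X` into the digital image `Y`. -/
def DigMapsTo (X : Set α) (Y : Set β) (f : α → β) : Prop := ∀ x ∈ X, f x ∈ Y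

/-- Digital `(A,B)`-continuity of `f` on `X`: adjacent points go to equal or
adjacent points. -/
def DigContinuousOn (X : Set α) (f : α → β) : Prop :=
  ∀ x ∈ X, ∀ x' ∈ X, A x x' → f x = f x' ∨ B (f x) (f x')

/-- Digital homotopy between `f` and `g` as maps from `(X, A)` to `(Y, B)`. -/
def DigHomotopic (X : Set α) (Y : Set β) (f g : α → β) : Prop :=
  ∃ (m : ℕ) (F : α → ℤ → β),
    (∀ x ∈ X, ∀ t ∈ Set.Icc (0 : ℤ) (m : ℤ), F x t ∈ Y) ∧
    (∀ x ∈ X, F x 0 = f x) ∧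
    (∀ x ∈ X, F x (m : ℤ) = g x) ∧
    (∀ t ∈ Set.Icc (0 : ℤ) (m : ℤ), DigContinuousOn A B X fun x => F x t) ∧
    (∀ x ∈ X, ∀ t ∈ Set.Icc (0 : ℤ) (m : ℤ), ∀ t' ∈ Set.Icc (0 : ℤ) (m : ℤ),
      adjZ t t' → F x t = F x t' ∨ B (F x t) (F x t'))

/-- The given map `f : (X, A) → (Y, B)` is a digital homotopy equivalence. -/
def IsDigHomotopyEquiv (X : Set α) (Y : Set β) (f : α → β) : Prop :=
  DigMapsTo X Y f ∧ DigContinuousOn A B X f ∧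
    ∃ g : β → α, DigMapsTo Y X g ∧ DigContinuousOn B A Y g ∧
      DigHomotopic A A X X (g ∘ f) id ∧ DigHomotopic B B Y Y (f ∘ g) id

/-- `(X, A)` and `(Y, B)` are digitally homotopy equivalent. -/
def DigHomotopyEquiv (X : Set α) (Y : Set β) : Prop :=
  ∃ f : α → β, IsDigHomotopyEquiv A B X Y f

/-- `(X, A)` is digitally contractible. -/
def DigContractible (X : Set α) : Prop :=
  ∃ x₀ ∈ X, DigHomotopic A A X X id fun _ => x₀

/-- `(X, A)` is digitally connected. -/
def DigConnected (X : Set α) : Prop :=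
  ∀ x ∈ X, ∀ y ∈ X, Relation.ReflTransGen (fun a b => a ∈ X ∧ b ∈ X ∧ A a b) x y

/-- `(X, A)` is reducible: digitally homotopy equivalent to a digital image
(a subset of some `ℤⁿ` with a `c_k`-adjacency) with strictly fewer points. -/
def Reducible (X : Set α) : Prop :=
  ∃ (n k : ℕ) (Y : Set (Fin n → ℤ)), 1 ≤ k ∧ k ≤ n ∧ Y.Finite ∧
    Y.ncard < X.ncard ∧ DigHomotopyEquiv A (cAdj n k) X Y

/-- Value of a path at time `t`, extended past its endpoint by its final value. -/
def DigPath.eval (p : DigPath α) (t : ℤ) : α := p.toFun (min t (p.len : ℤ))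

/-- `p` is a digital path in `(X, A)`. -/
def IsDigPath (X : Set α) (p : DigPath α) : Prop :=
  (∀ t ∈ Set.Icc (0 : ℤ) (p.len : ℤ), p.toFun t ∈ X) ∧
    ∀ t ∈ Set.Icc (0 : ℤ) (p.len : ℤ), ∀ t' ∈ Set.Icc (0 : ℤ) (p.len : ℤ),
      adjZ t t' → p.toFun t = p.toFun t' ∨ A (p.toFun t) (p.toFun t')

/-- Adjacency of digital paths in `PX`: after extending the shorter one by its final
value, values at every time are equal or adjacent. -/
def pathAdj (p q : DigPath α) : Prop :=
  ∀ t ∈ Set.Icc (0 : ℤ) ((max p.len q.len : ℕ) : ℤ),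
    p.eval t = q.eval t ∨ A (p.eval t) (q.eval t)

/-- Product adjacency on `X × X`. -/
def prodAdj (u v : α × α) : Prop :=
  u ≠ v ∧ (u.1 = v.1 ∨ A u.1 v.1) ∧ (u.2 = v.2 ∨ A u.2 v.2)

/-- `TCle A X k`: `X × X` is covered by `k` subsets, each admitting a digitally
continuous motion planning section of `π : PX → X × X`. -/
def TCle (X : Set α) (k : ℕ) : Prop :=
  ∃ U : Fin k → Set (α × α),
    (⋃ j, U j) = X ×ˢ X ∧
    ∀ j, ∃ s : α × α → DigPath α,
      (∀ u ∈ U j, IsDigPath A X (s u)) ∧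
      DigContinuousOn (prodAdj A) (pathAdj A) (U j) s ∧
      ∀ u ∈ U j, (s u).toFun 0 = u.1 ∧ (s u).toFun ((s u).len : ℤ) = u.2

/-- The digital topological complexity `TC(X, A)` (`∞` if no finite cover works). -/
noncomputable def digTC (X : Set α) : ℕ∞ :=
  sInf {N : ℕ∞ | ∃ k : ℕ, N = (k : ℕ∞) ∧ TCle A X k}

/-- Membership in `Sₙ(X)`: the path lies in `X` and each marked point is in its image. -/
def InSn {n : ℕ} (X : Set α) (s : SnElt α n) : Prop :=
  IsDigPath A X s.path ∧
    ∀ i, ∃ t ∈ Set.Icc (0 : ℤ) (s.path.len : ℤ), s.path.toFun t = s.pts i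

/-- Adjacency on `Sₙ(X)`. -/
def snAdj {n : ℕ} (s s' : SnElt α n) : Prop :=
  s ≠ s' ∧ pathAdj A s.path s'.path ∧
    ∀ i, s.pts i = s'.pts i ∨ A (s.pts i) (s'.pts i)

/-- Product adjacency on `Xⁿ`. -/
def prodAdjN {n : ℕ} (u v : Fin n → α) : Prop :=
  u ≠ v ∧ ∀ i, u i = v i ∨ A (u i) (v i)

/-- `TCnle A X n k`: `Xⁿ` is covered by `k` subsets, each admitting a digitally
continuous section of `eₙ' : Sₙ(X) → Xⁿ`. -/
def TCnle (X : Set α) (n k : ℕ) : Prop :=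
  ∃ U : Fin k → Set (Fin n → α),
    (⋃ j, U j) = {u : Fin n → α | ∀ i, u i ∈ X} ∧
    ∀ j, ∃ s : (Fin n → α) → SnElt α n,
      (∀ u ∈ U j, InSn A X (s u)) ∧
      DigContinuousOn (prodAdjN A) (snAdj A) (U j) s ∧
      ∀ u ∈ U j, (s u).pts = u

/-- The digital higher topological complexity `TCₙ(X, A)`, i.e. the digital Schwarz
genus of `eₙ' : Sₙ(X) → Xⁿ`. -/
noncomputable def digTCn (X : Set α) (n : ℕ) : ℕ∞ :=
  sInf {N : ℕ∞ | ∃ k : ℕ, N = (k : ℕ∞) ∧ TCnle A X n k}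

/-- `C` is a digital simple closed `A`-curve with `m` points. -/
def IsSimpleClosedCurve (C : Set α) (m : ℕ) : Prop :=
  4 ≤ m ∧ ∃ f : ℤ → α,
    C = f '' Set.Icc (0 : ℤ) ((m : ℤ) - 1) ∧
    Set.InjOn f (Set.Icc (0 : ℤ) ((m : ℤ) - 1)) ∧
    (∀ t ∈ Set.Icc (0 : ℤ) ((m : ℤ) - 1), ∀ t' ∈ Set.Icc (0 : ℤ) ((m : ℤ) - 1),
      adjZ t t' → f t = f t' ∨ A (f t) (f t')) ∧
    A (f 0) (f ((m : ℤ) - 1)) ∧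
    ∀ t ∈ Set.Icc (0 : ℤ) ((m : ℤ) - 1), ∀ t' ∈ Set.Icc (0 : ℤ) ((m : ℤ) - 1),
      A (f t) (f t') → f t' = f ((t - 1) % (m : ℤ)) ∨ f t' = f ((t + 1) % (m : ℤ))

/-- Adjacency on the digital `m`-cycle `ℤ/mℤ`: `i` adjacent to `i ± 1`. -/
def cmAdj (m : ℕ) (i j : ZMod m) : Prop := i ≠ j ∧ (j = i + 1 ∨ i = j + 1)

/-- The set of digital `m`-loops in `(X, A)`. -/
def mLoops (X : Set α) (m : ℕ) : Set (ZMod m → α) :=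
  {f | (∀ i, f i ∈ X) ∧ ∀ i j, cmAdj m i j → f i = f j ∨ A (f i) (f j)}

/-- `Lnum A X m` = the number of digital homotopy classes of `m`-loops in `(X, A)`. -/
noncomputable def Lnum (X : Set α) (m : ℕ) : ℕ :=
  Set.ncard {S : Set (ZMod m → α) | ∃ f ∈ mLoops A X m,
    S = {g | g ∈ mLoops A X m ∧ DigHomotopic (cmAdj m) A Set.univ X f g}}

end

section

variable {α β : Type} {A : α → α → Prop} {X : Set α}

/-- Reversing the time parameter of a digital homotopy. -/
theorem DigHomotopic.symm {B : β → β → Prop} {Y : Set β} {f g : α → β}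
    (h : DigHomotopic A B X Y f g) : DigHomotopic A B X Y g f := by
  obtain ⟨m, F, hmaps, hf, hg, hcont, hpath⟩ := h
  have hrev : ∀ t ∈ Set.Icc (0 : ℤ) m, (m : ℤ) - t ∈ Set.Icc (0 : ℤ) m := by
    intro t ht
    rw [Set.mem_Icc] at ht ⊢
    omega
  refine ⟨m, fun x t => F x (m - t), fun x hx t ht => hmaps x hx _ (hrev t ht), ?_, ?_,
    fun t ht => hcont _ (hrev t ht), ?_⟩
  · intro x hx
    simpa using hg x hx
  · intro x hx
    simpa using hf x hx
  · intro x hx t ht t' ht' htt'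
    refine hpath x hx _ (hrev t ht) _ (hrev t' ht') ?_
    unfold adjZ at htt' ⊢
    rw [abs_sub_comm] at htt'
    rwa [sub_sub_sub_cancel_left]

theorem DigPath.eval_of_len_le {p : DigPath α} {t : ℤ} (h : (p.len : ℤ) ≤ t) :
    p.eval t = p.toFun p.len := by
  rw [DigPath.eval, min_eq_right h]

theorem IsDigPath.eval_mem {p : DigPath α} (hp : IsDigPath A X p) {t : ℤ} (ht : 0 ≤ t) :
    p.eval t ∈ X :=
  hp.1 _ ⟨le_min ht (Int.natCast_nonneg _), min_le_right _ _⟩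

theorem IsDigPath.eval_adj {p : DigPath α} (hp : IsDigPath A X p) {t t' : ℤ} (ht : 0 ≤ t)
    (ht' : 0 ≤ t') (h : adjZ t t') : p.eval t = p.eval t' ∨ A (p.eval t) (p.eval t') := by
  by_cases heq : min t (p.len : ℤ) = min t' (p.len : ℤ)
  · left
    rw [DigPath.eval, DigPath.eval, heq]
  · refine hp.2 _ ⟨le_min ht (Int.natCast_nonneg _), min_le_right _ _⟩ _
      ⟨le_min ht' (Int.natCast_nonneg _), min_le_right _ _⟩ ?_
    rw [adjZ, abs_eq zero_le_one] at h ⊢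
    omega

/-- A digital image with topological complexity at most one is contractible: the motions from
each point to a fixed base point form a contraction. -/
theorem TCle.digContractible (hfin : X.Finite) (hne : X.Nonempty)
    (hA : ∀ x, ¬ A x x) (h : TCle A X 1) : DigContractible A X := by
  obtain ⟨U, hU, hs⟩ := h
  obtain ⟨x₀, hx₀⟩ := hne
  obtain ⟨s, hpath, hcont, hend⟩ := hs 0
  have hmem : ∀ x ∈ X, (x, x₀) ∈ U 0 := by
    intro x hx
    have hx' : (x, x₀) ∈ ⋃ j, U j := hU ▸ ⟨hx, hx₀⟩
    obtain ⟨j, hj⟩ := Set.mem_iUnion.1 hx'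
    rwa [Subsingleton.elim j 0] at hj
  obtain ⟨M, hM⟩ := (hfin.image fun x => (s (x, x₀)).len).bddAbove
  have hlen : ∀ x ∈ X, (s (x, x₀)).len ≤ M := fun x hx => hM ⟨x, hx, rfl⟩
  refine ⟨x₀, hx₀, M, fun x t => (s (x, x₀)).eval t,
    fun x hx t ht => (hpath _ (hmem x hx)).eval_mem ht.1, ?_, ?_, ?_,
    fun x hx t ht t' ht' => (hpath _ (hmem x hx)).eval_adj ht.1 ht'.1⟩
  · intro x hx
    simpa [DigPath.eval] using (hend _ (hmem x hx)).1
  · intro x hx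
    change (s (x, x₀)).eval M = x₀
    rw [DigPath.eval_of_len_le (by exact_mod_cast hlen x hx), (hend _ (hmem x hx)).2]
  · intro t ht x hx x' hx' hxx'
    have hadj : prodAdj A (x, x₀) (x', x₀) := by
      refine ⟨fun he => ?_, Or.inr hxx', Or.inl rfl⟩
      obtain rfl : x = x' := congrArg Prod.fst he
      exact hA x hxx'
    change (s (x, x₀)).eval t = (s (x', x₀)).eval t ∨
      A ((s (x, x₀)).eval t) ((s (x', x₀)).eval t)
    rcases hcont _ (hmem x hx) _ (hmem x' hx') hadj with he | hp
    · rw [he]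
      exact Or.inl rfl
    · rcases le_total t ((max (s (x, x₀)).len (s (x', x₀)).len : ℕ) : ℤ) with hle | hle
      · exact hp t ⟨ht.1, hle⟩
      · left
        rw [Nat.cast_max, max_le_iff] at hle
        rw [DigPath.eval_of_len_le hle.1, DigPath.eval_of_len_le hle.2,
          (hend _ (hmem x hx)).2, (hend _ (hmem x' hx')).2]

/-- A contractible digital image with more than one point is reducible. -/
theorem DigContractible.reducible (hcard : 1 < X.ncard) (h : DigContractible A X) :
    Reducible A X := by
  obtain ⟨x₀, hx₀, hhom⟩ := h
  refine ⟨1, 1, {0}, le_rfl, le_rfl, Set.finite_singleton 0, by simpa using hcard,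
    fun _ => 0, fun _ _ => rfl, fun _ _ _ _ _ => Or.inl rfl, fun _ => x₀, fun _ _ => hx₀,
    fun _ _ _ _ _ => Or.inl rfl, hhom.symm, ?_⟩
  exact ⟨0, fun _ _ => 0, fun _ _ _ _ => rfl, fun _ _ => rfl, fun _ hy => Eq.symm hy,
    fun _ _ _ _ _ _ _ => Or.inl rfl, fun _ _ _ _ _ _ _ => Or.inl rfl⟩

theorem not_TCle_zero (hne : X.Nonempty) : ¬ TCle A X 0 := by
  rintro ⟨U, hU, -⟩
  obtain ⟨x, hx⟩ := hne
  have hmem : (x, x) ∈ ⋃ j, U j := hU ▸ ⟨hx, hx⟩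
  simp at hmem

theorem one_lt_digTC (hne : X.Nonempty) (h : ¬ TCle A X 1) : 1 < digTC A X := by
  have htwo : (2 : ℕ∞) ≤ digTC A X := by
    refine le_sInf ?_
    rintro _ ⟨k, rfl, hk⟩
    have hk0 : k ≠ 0 := fun h0 => not_TCle_zero hne (h0 ▸ hk)
    have hk1 : k ≠ 1 := fun h1 => h (h1 ▸ hk)
    have hle : 2 ≤ k := by omega
    exact_mod_cast hle
  exact lt_of_lt_of_le (by norm_num) htwo

end

/-- a digitally connected finite digital image with more than one point
that is irreducible has TC > 1. -/
theorem stmt_1 (n k : ℕ) (hk1 : 1 ≤ k) (hkn : k ≤ n)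
    (X : Set (Fin n → ℤ)) (hfin : X.Finite) (hcard : 1 < X.ncard)
    (hconn : DigConnected (cAdj n k) X)
    (hirr : ¬ Reducible (cAdj n k) X) :
    1 < digTC (cAdj n k) X := by
  have hne : X.Nonempty := Set.nonempty_of_ncard_ne_zero (by omega)
  exact one_lt_digTC hne fun h =>
    hirr ((h.digContractible hfin hne fun _ hx => hx.1 rfl).reducible hcard)
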